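/- Let U = {x ∈ ℝ³ : ‖x‖ > 1} and let Y : ℝ³ → ℝ³ be twice continuously differentiable on U. Suppose that for every x ∈ U and all v, w ∈ ℝ³ one has ⟨(DY(x))v, w⟩ + ⟨(DY(x))w, v⟩ = 0 (i.e. Y is a Killing field of the Euclidean metric on U), and that Y(x) → 0 as ‖x‖ → ∞. Then Y(x) = 0 for all x ∈ U. -/

import Mathlib

open Filter Topology in
theorem killing_ray_aux (Y : EuclideanSpace ℝ (Fin 3) → EuclideanSpace ℝ (Fin 3))
    (hY : ContDiffOn ℝ 2 Y {x : EuclideanSpace ℝ (Fin 3) | 1 < ‖x‖})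
    (hKilling : ∀ x : EuclideanSpace ℝ (Fin 3), 1 < ‖x‖ →
      ∀ v w : EuclideanSpace ℝ (Fin 3),
        (inner ℝ (fderiv ℝ Y x v) w : ℝ) + (inner ℝ (fderiv ℝ Y x w) v : ℝ) = 0)
    (hdecay : Filter.Tendsto Y (Filter.comap norm Filter.atTop) (nhds 0))
    (x v : EuclideanSpace ℝ (Fin 3)) (hx : 1 < ‖x‖) (hv : 0 ≤ (inner ℝ x v : ℝ)) :
    (inner ℝ (Y x) v : ℝ) = 0 := by
  by_cases hv0 : v = 0
  · simp [hv0]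
  have hray : ∀ t : ℝ, 0 ≤ t → 1 < ‖x + t • v‖ := by
    intro t ht
    have h1 : ‖x + t • v‖ ^ 2 = ‖x‖ ^ 2 + 2 * (t * inner ℝ x v) + ‖t • v‖ ^ 2 := by
      rw [norm_add_sq_real, inner_smul_right]
    have h2 : 0 ≤ t * (inner ℝ x v : ℝ) := mul_nonneg ht hv
    by_contra hcon
    have h3 : ‖x + t • v‖ ≤ 1 := not_lt.mp hcon
    nlinarith [norm_nonneg (x + t • v), sq_nonneg ‖t • v‖]
  have hopen : IsOpen {x : EuclideanSpace ℝ (Fin 3) | 1 < ‖x‖} :=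
    isOpen_lt continuous_const continuous_norm
  have hderiv : ∀ t : ℝ, 0 ≤ t →
      HasDerivAt (fun s : ℝ => (inner ℝ (Y (x + s • v)) v : ℝ)) 0 t := by
    intro t ht
    have hd : HasFDerivAt Y (fderiv ℝ Y (x + t • v)) (x + t • v) :=
      ((hY.contDiffAt (hopen.mem_nhds (hray t ht))).differentiableAt (by norm_num)).hasFDerivAt
    have hl : HasDerivAt (fun s : ℝ => x + s • v) v t := by
      simpa using ((hasDerivAt_id t).smul_const v).const_add x
    have hc := hd.comp_hasDerivAt t hl
    have hi := hc.inner ℝ (hasDerivAt_const t v)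
    have hk := hKilling _ (hray t ht) v v
    have hk0 : (inner ℝ (fderiv ℝ Y (x + t • v) v) v : ℝ) = 0 := by linarith
    simpa [hk0] using hi
  have hconst : ∀ t : ℝ, 0 ≤ t → (inner ℝ (Y (x + t • v)) v : ℝ) = inner ℝ (Y x) v := by
    intro t ht
    have := constant_of_has_deriv_right_zero
      (f := fun s : ℝ => (inner ℝ (Y (x + s • v)) v : ℝ)) (a := 0) (b := t)
      (fun s hs => (hderiv s hs.1).continuousAt.continuousWithinAt)
      (fun s hs => (hderiv s hs.1).hasDerivWithinAt) t ⟨ht, le_rfl⟩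
    simpa using this
  have hnorm : Tendsto (fun t : ℝ => ‖x + t • v‖) atTop atTop := by
    have h1 : Tendsto (fun t : ℝ => t * ‖v‖ + (-‖x‖)) atTop atTop :=
      tendsto_atTop_add_const_right _ _ (tendsto_id.atTop_mul_const (norm_pos_iff.mpr hv0))
    refine tendsto_atTop_mono' _ ?_ h1
    filter_upwards [eventually_ge_atTop 0] with t ht
    have h2 : ‖t • v‖ = t * ‖v‖ := by rw [norm_smul, Real.norm_of_nonneg ht]
    have h3 : ‖t • v‖ ≤ ‖x + t • v‖ + ‖x‖ := by
      simpa using norm_sub_le (x + t • v) x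
    linarith
  have hlim : Tendsto (fun t : ℝ => (inner ℝ (Y (x + t • v)) v : ℝ)) atTop (𝓝 0) := by
    have h1 := (hdecay.comp (tendsto_comap_iff.mpr hnorm)).inner
      (𝕜 := ℝ) (tendsto_const_nhds (x := v))
    simpa using h1
  have hlim2 : Tendsto (fun t : ℝ => (inner ℝ (Y (x + t • v)) v : ℝ)) atTop
      (𝓝 (inner ℝ (Y x) v)) := by
    refine tendsto_const_nhds.congr' ?_
    filter_upwards [eventually_ge_atTop 0] with t ht
    exact (hconst t ht).symm
  exact tendsto_nhds_unique hlim2 hlim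


/-- A Killing field of the Euclidean metric on the exterior region
`U = {x ∈ ℝ³ : ‖x‖ > 1}` (i.e. a `C²` vector field `Y` with `DY(x)` skew-symmetric at
every point of `U`) which tends to `0` as `‖x‖ → ∞` vanishes identically on `U`. -/
theorem stmt_9 (Y : EuclideanSpace ℝ (Fin 3) → EuclideanSpace ℝ (Fin 3))
    (hY : ContDiffOn ℝ 2 Y {x : EuclideanSpace ℝ (Fin 3) | 1 < ‖x‖})
    (hKilling : ∀ x : EuclideanSpace ℝ (Fin 3), 1 < ‖x‖ →
      ∀ v w : EuclideanSpace ℝ (Fin 3),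
        (inner ℝ (fderiv ℝ Y x v) w : ℝ) + (inner ℝ (fderiv ℝ Y x w) v : ℝ) = 0)
    (hdecay : Filter.Tendsto Y (Filter.comap norm Filter.atTop) (nhds 0)) :
    ∀ x : EuclideanSpace ℝ (Fin 3), 1 < ‖x‖ → Y x = 0 := by
  intro x hx
  rw [← inner_self_eq_zero (𝕜 := ℝ)]
  rcases le_total 0 (inner ℝ x (Y x) : ℝ) with h | h
  · exact killing_ray_aux Y hY hKilling hdecay x (Y x) hx h
  · have := killing_ray_aux Y hY hKilling hdecay x (-Y x) hx (by rw [inner_neg_right]; linarith)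
    rw [inner_neg_right] at this
    linarith
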